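/- arXiv:1403.0945 — 2 statements merged into one kernel-verified Lean document; each statement's English description precedes it below -/
import Mathlib

section
/- There exists a constant C > 0 such that for every N ∈ ℕ and every function a : ℤ/Nℤ → ℂ, sup_{t∈ℝ} |E_{n∈[N]} a(n) e(nt)| ≤ C · ‖a‖_{U²(ℤ_N)}. -/
open Finset

/-- The Gowers uniformity norm `‖a‖_{U^s(ℤ_N)}`, defined inductively. -/
noncomputable def gowersNorm (N : ℕ) [NeZero N] : ℕ → (ZMod N → ℂ) → ℝ
  | 0, a => ‖(∑ n : ZMod N, a n) / (N : ℂ)‖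
  | 1, a => ‖(∑ n : ZMod N, a n) / (N : ℂ)‖
  | (s + 2), a =>
      ((∑ t : ZMod N,
          gowersNorm N (s + 1) (fun n => a n * (starRingEnd ℂ) (a (n + t))) ^ 2 ^ (s + 1))
        / (N : ℝ)) ^ ((1 : ℝ) / 2 ^ (s + 2))

open ZMod

/-- Fourier inversion on `ZMod N`. -/
lemma ZMod.sum_stdAddChar_mul_dft {N : ℕ} [NeZero N] (g : ZMod N → ℂ) (t : ZMod N) :
    ∑ ξ, stdAddChar (ξ * t) * dft g ξ = N * g t := by
  have := congrFun (dft_dft g) (-t)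
  simpa [dft_apply (dft g)] using this

/-- Parseval's identity for the discrete Fourier transform on `ZMod N`. -/
lemma ZMod.sum_norm_sq_dft {N : ℕ} [NeZero N] (g : ZMod N → ℂ) :
    ∑ ξ, ‖dft g ξ‖ ^ 2 = N * ∑ t, ‖g t‖ ^ 2 := by
  have key : ∑ ξ, dft g ξ * (starRingEnd ℂ) (dft g ξ)
      = (N : ℂ) * ∑ t, g t * (starRingEnd ℂ) (g t) := by
    calc ∑ ξ, dft g ξ * (starRingEnd ℂ) (dft g ξ)
        = ∑ ξ, ∑ t, (starRingEnd ℂ) (g t) * (stdAddChar (ξ * t) * dft g ξ) := by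
          refine sum_congr rfl fun ξ _ => ?_
          conv_lhs => enter [2]; rw [dft_apply g ξ]
          rw [map_sum, mul_sum]
          refine sum_congr rfl fun t _ => ?_
          rw [smul_eq_mul, map_mul, AddChar.map_neg_eq_conj, Complex.conj_conj, mul_comm t ξ]
          ring
      _ = ∑ t, (starRingEnd ℂ) (g t) * (N * g t) := by
          rw [sum_comm]
          simp only [← mul_sum, sum_stdAddChar_mul_dft]
      _ = _ := by
          rw [mul_sum]
          exact sum_congr rfl fun t _ => by ring
  simp only [Complex.mul_conj'] at key
  exact_mod_cast key

/-- The Fourier transform of the autocorrelation of `a`. -/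
lemma ZMod.dft_autocorrelation {N : ℕ} [NeZero N] (a : ZMod N → ℂ) (ξ : ZMod N) :
    dft (fun t => ∑ n, a n * (starRingEnd ℂ) (a (n + t))) ξ = (‖dft a (-ξ)‖ ^ 2 : ℝ) := by
  push_cast
  rw [← Complex.mul_conj', dft_apply, dft_apply, map_sum, sum_mul_sum]
  simp only [smul_eq_mul, mul_sum]
  rw [sum_comm]
  refine sum_congr rfl fun n _ => ?_
  refine Fintype.sum_equiv (Equiv.addLeft n) _ _ fun t => ?_
  simp only [Equiv.coe_addLeft, map_mul, mul_neg, neg_neg]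
  rw [← AddChar.map_neg_eq_conj, add_mul, neg_add, AddChar.map_add_eq_mul]
  have : stdAddChar (n * ξ) * stdAddChar (-(n * ξ)) = (1 : ℂ) := by
    rw [← AddChar.map_add_eq_mul, add_neg_cancel, AddChar.map_zero_eq_one]
  linear_combination -(stdAddChar (-(t * ξ)) * a n * (starRingEnd ℂ) (a (n + t))) * this

/-- The `U²` norm is a normalized `ℓ⁴` norm of the Fourier transform. -/
lemma gowersNorm_two {N : ℕ} [NeZero N] (a : ZMod N → ℂ) :
    gowersNorm N 2 a = (∑ ξ, ‖dft a ξ‖ ^ 4) ^ (1 / 4 : ℝ) / N := by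
  have hN : (0 : ℝ) < N := Nat.cast_pos.mpr (NeZero.pos N)
  have h := sum_norm_sq_dft fun t => ∑ n, a n * (starRingEnd ℂ) (a (n + t))
  simp only [dft_autocorrelation, Complex.norm_real, norm_pow, norm_norm, ← pow_mul] at h
  have hneg : ∑ ξ, ‖dft a (-ξ)‖ ^ (2 * 2) = ∑ ξ, ‖dft a ξ‖ ^ (2 * 2) :=
    Equiv.sum_comp (Equiv.neg (ZMod N)) fun ξ => ‖dft a ξ‖ ^ (2 * 2)
  rw [hneg] at h
  have hroot : (N : ℝ) = ((N : ℝ) ^ 4) ^ (1 / 4 : ℝ) := by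
    rw [← Real.rpow_natCast, ← Real.rpow_mul hN.le]
    norm_num
  conv_rhs => rw [hroot]
  rw [← Real.div_rpow (sum_nonneg fun _ _ => by positivity) (by positivity)]
  simp only [gowersNorm, norm_div, Complex.norm_natCast, div_pow, ← sum_div]
  norm_num at h ⊢
  rw [h]
  congr 1
  field_simp

/-- Lower bound for a chord of the unit circle near an `N`-th root of unity. -/
lemma norm_exp_sub_one_ge {N : ℕ} (hN : 0 < N) {j : ℤ} (hj : 2 * |(j : ℝ)| ≤ N) (hj0 : j ≠ 0)
    {θ : ℝ} (hθ : |θ| ≤ 1 / 2) :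
    |(j : ℝ)| / (2 * N) ≤ ‖Complex.exp (Complex.I * ↑(2 * Real.pi * ((j + θ) / N))) - 1‖ := by
  have hN' : (0 : ℝ) < N := Nat.cast_pos.mpr hN
  have hj1 : (1 : ℝ) ≤ |(j : ℝ)| := by exact_mod_cast Int.one_le_abs hj0
  have hpi := Real.pi_pos
  have hpi' := Real.pi_lt_d2
  have h1 : 4 * |(j : ℝ)| / N ≤ ‖Complex.exp (Complex.I * ↑(2 * Real.pi * (j / N))) - 1‖ := by
    rw [Complex.norm_exp_I_mul_ofReal_sub_one, norm_mul, Real.norm_eq_abs, Real.norm_eq_abs]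
    have : |2 * Real.pi * (j / N) / 2| = Real.pi * (|(j : ℝ)| / N) := by
      rw [show 2 * Real.pi * (j / N) / 2 = Real.pi * (j / N) by ring, abs_mul, abs_div,
        abs_of_pos hpi, abs_of_pos hN']
    have h := Real.mul_abs_le_abs_sin (x := 2 * Real.pi * (j / N) / 2) (by
      rw [this, div_eq_mul_one_div Real.pi]
      refine mul_le_mul_of_nonneg_left ?_ hpi.le
      rw [div_le_div_iff₀ hN' two_pos]
      linarith)
    rw [this] at h
    calc 4 * |(j : ℝ)| / N = 2 * (2 / Real.pi * (Real.pi * (|(j : ℝ)| / N))) := by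
          field_simp; norm_num
      _ ≤ _ := by rw [abs_two]; gcongr
  have h2 : ‖Complex.exp (Complex.I * ↑(2 * Real.pi * (θ / N))) - 1‖ ≤ Real.pi / N := by
    refine Real.norm_exp_I_mul_ofReal_sub_one_le.trans ?_
    rw [Real.norm_eq_abs, abs_mul, abs_div, abs_of_pos hN', abs_of_pos (by positivity)]
    calc 2 * Real.pi * (|θ| / N) ≤ 2 * Real.pi * (1 / 2 / N) := by gcongr
      _ = Real.pi / N := by ring
  have h3 : ‖Complex.exp (Complex.I * ↑(2 * Real.pi * (j / N))) - 1‖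
      ≤ ‖Complex.exp (Complex.I * ↑(2 * Real.pi * ((j + θ) / N))) - 1‖
        + ‖Complex.exp (Complex.I * ↑(2 * Real.pi * (θ / N))) - 1‖ := by
    set u := Complex.exp (Complex.I * ↑(2 * Real.pi * (j / N)))
    have hu : ‖u‖ = 1 := Complex.norm_exp_I_mul_ofReal _
    have hmul : Complex.exp (Complex.I * ↑(2 * Real.pi * ((j + θ) / N)))
        = u * Complex.exp (Complex.I * ↑(2 * Real.pi * (θ / N))) := by
      rw [← Complex.exp_add]
      congr 1
      push_cast
      ring
    rw [hmul]
    set v := Complex.exp (Complex.I * ↑(2 * Real.pi * (θ / N)))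
    calc ‖u - 1‖ = ‖(u * v - 1) - u * (v - 1)‖ := by congr 1; ring
      _ ≤ ‖u * v - 1‖ + ‖u * (v - 1)‖ := norm_sub_le _ _
      _ = _ := by rw [norm_mul u, hu, one_mul]
  have h4 : |(j : ℝ)| / (2 * N) + Real.pi / N ≤ 4 * |(j : ℝ)| / N := by
    rw [show |(j : ℝ)| / (2 * N) + Real.pi / N = (|(j : ℝ)| / 2 + Real.pi) / N by
      field_simp]
    gcongr
    linarith
  linarith

lemma norm_sum_Icc_pow_mul_norm_sub_one_le {z : ℂ} (hz : ‖z‖ = 1) (N : ℕ) :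
    ‖∑ n ∈ Icc 1 N, z ^ n‖ * ‖z - 1‖ ≤ 2 := by
  rw [← norm_mul]
  have : (∑ n ∈ Icc 1 N, z ^ n) * (z - 1) = z * (z ^ N - 1) := by
    rw [← geom_sum_mul, range_eq_Ico, ← Finset.Ico_add_one_right_eq_Icc,
      sum_Ico_eq_sum_range, ← range_eq_Ico]
    simp only [pow_add, ← mul_sum, add_tsub_cancel_right, pow_one]
    ring
  rw [this, norm_mul, hz, one_mul]
  refine (norm_sub_le _ _).trans ?_
  rw [norm_pow, hz]
  norm_num

/-- Decay of the Fourier coefficients of a linear phase on `[N]`. -/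
lemma norm_dft_linearPhase_le {N : ℕ} [NeZero N] (t : ℝ) (ξ : ZMod N) :
    ‖∑ n ∈ Icc 1 N, stdAddChar (ξ * (n : ZMod N)) * Complex.exp (2 * Real.pi * Complex.I * n * t)‖
      ≤ 4 * N * (max 1 |((ξ + (round (N * t) : ℤ)).valMinAbs : ℝ)|)⁻¹ := by
  have hNpos := NeZero.pos N
  have hN : (0 : ℝ) < N := Nat.cast_pos.mpr hNpos
  set k := round (N * t)
  set j := (ξ + (k : ℤ)).valMinAbs with hjdef
  set θ : ℝ := N * t - k
  have hθ : |θ| ≤ 1 / 2 := abs_sub_round _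
  set z := Complex.exp (Complex.I * ↑(2 * Real.pi * ((j + θ) / N))) with hz
  have hz1 : ‖z‖ = 1 := Complex.norm_exp_I_mul_ofReal _
  have hξ : ξ = ((j - k : ℤ) : ZMod N) := by
    push_cast
    rw [hjdef, coe_valMinAbs]
    ring
  have hsum : ∑ n ∈ Icc 1 N, stdAddChar (ξ * (n : ZMod N)) *
      Complex.exp (2 * Real.pi * Complex.I * n * t) = ∑ n ∈ Icc 1 N, z ^ n := by
    refine sum_congr rfl fun n _ => ?_
    rw [hξ, show (((j - k : ℤ) : ZMod N) * (n : ZMod N)) = (((j - k) * n : ℤ) : ZMod N) by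
      push_cast; ring, stdAddChar_coe, ← Complex.exp_add, hz, ← Complex.exp_nat_mul]
    congr 1
    have hN0 : (N : ℂ) ≠ 0 := Nat.cast_ne_zero.mpr hNpos.ne'
    simp only [θ]
    push_cast
    field_simp
    ring
  rw [hsum]
  by_cases hj0 : j = 0
  · rw [hj0]
    calc ‖∑ n ∈ Icc 1 N, z ^ n‖ ≤ ∑ n ∈ Icc 1 N, ‖z ^ n‖ := norm_sum_le _ _
      _ = N := by simp [hz1]
      _ ≤ _ := by simp; linarith
  · have hj1 : (1 : ℝ) ≤ |(j : ℝ)| := by exact_mod_cast Int.one_le_abs hj0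
    have hjN : 2 * |(j : ℝ)| ≤ N := by
      have h := (ξ + (k : ℤ)).natAbs_valMinAbs_le
      have h' : 2 * |j| ≤ N := by rw [Int.abs_eq_natAbs]; omega
      exact_mod_cast h'
    have hlow := norm_exp_sub_one_ge hNpos hjN hj0 hθ
    have hup := norm_sum_Icc_pow_mul_norm_sub_one_le hz1 N
    rw [max_eq_right hj1, ← div_eq_mul_inv, le_div_iff₀ (by positivity)]
    have := (mul_le_mul_of_nonneg_left hlow (norm_nonneg (∑ n ∈ Icc 1 N, z ^ n))).trans hup
    rw [← mul_div_assoc, div_le_iff₀ (by positivity)] at this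
    linarith

lemma summable_max_one_abs_inv_rpow {p : ℝ} (hp : 1 < p) :
    Summable fun j : ℤ => ((max 1 |(j : ℝ)|)⁻¹) ^ p := by
  refine (Summable.add (Real.summable_abs_int_rpow hp)
    (summable_of_ne_finset_zero (f := fun j : ℤ => if j = 0 then (1 : ℝ) else 0)
      (s := {0}) (by simp))).of_nonneg_of_le (fun j => by positivity) fun j => ?_
  by_cases hj : j = 0
  · simp [hj, Real.rpow_nonneg]
  · have hj1 : (1 : ℝ) ≤ |(j : ℝ)| := by exact_mod_cast Int.one_le_abs hj
    rw [max_eq_right hj1, Real.inv_rpow (abs_nonneg _), ← Real.rpow_neg (abs_nonneg _)]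
    simp [hj]

/-- Expansion of the correlation of `a` with a linear phase in Fourier coefficients. -/
lemma natCast_mul_sum_Icc_mul_exp {N : ℕ} [NeZero N] (a : ZMod N → ℂ) (t : ℝ) :
    (N : ℂ) * ∑ n ∈ Icc 1 N, a (n : ZMod N) * Complex.exp (2 * Real.pi * Complex.I * n * t)
      = ∑ ξ, dft a ξ *
          ∑ n ∈ Icc 1 N, stdAddChar (ξ * (n : ZMod N)) * Complex.exp (2 * Real.pi * Complex.I * n * t) := by
  simp only [mul_sum]
  rw [sum_comm]
  refine sum_congr rfl fun n _ => ?_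
  rw [← mul_assoc, ← sum_stdAddChar_mul_dft, sum_mul]
  exact sum_congr rfl fun ξ _ => by ring

/-- There is a constant `C > 0` such that for every `N` and every `a : ℤ/Nℤ → ℂ`,
`sup_{t∈ℝ} |E_{n∈[N]} a(n) e(nt)| ≤ C ‖a‖_{U²(ℤ_N)}`. -/
theorem stmt_6 :
    ∃ C : ℝ, 0 < C ∧
      ∀ (N : ℕ) [NeZero N], ∀ (a : ZMod N → ℂ) (t : ℝ),
        ‖(∑ n ∈ Finset.Icc 1 N,
            a (n : ZMod N) * Complex.exp (2 * Real.pi * Complex.I * (n : ℂ) * (t : ℂ)))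
          / (N : ℂ)‖ ≤ C * gowersNorm N 2 a := by
  set K : ℝ := ∑' j : ℤ, ((max 1 |(j : ℝ)|)⁻¹) ^ (4 / 3 : ℝ)
  have hsummable := summable_max_one_abs_inv_rpow (p := 4 / 3) (by norm_num)
  have hK0 : 0 < K := hsummable.tsum_pos (fun j => by positivity) 0 (by simp)
  refine ⟨4 * K ^ (3 / 4 : ℝ), by positivity, fun N _ a t => ?_⟩
  have hN : (0 : ℝ) < N := Nat.cast_pos.mpr (NeZero.pos N)
  set w : ZMod N → ℝ := fun ξ => (max 1 |((ξ + (round (N * t) : ℤ)).valMinAbs : ℝ)|)⁻¹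
  have hw0 (ξ : ZMod N) : 0 ≤ w ξ := by positivity
  have hw : ∑ ξ, w ξ ^ (4 / 3 : ℝ) ≤ K := by
    rw [← tsum_fintype (L := .unconditional _)]
    exact tsum_comp_le_tsum_of_inj hsummable (fun j => by positivity)
      ((injective_valMinAbs).comp (add_left_injective ((round (N * t) : ℤ) : ZMod N)))
  have hholder := Real.inner_le_Lp_mul_Lq_of_nonneg univ
    (f := fun ξ => ‖dft a ξ‖) (g := w) (p := 4) (q := 4 / 3)
    (Real.holderConjugate_iff.mpr (by norm_num))
    (fun ξ _ => norm_nonneg _) fun ξ _ => hw0 ξ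
  have hpow : ∑ ξ, ‖dft a ξ‖ ^ (4 : ℝ) = ∑ ξ, ‖dft a ξ‖ ^ 4 :=
    sum_congr rfl fun ξ _ => by norm_cast
  rw [hpow, show (1 / (4 / 3) : ℝ) = 3 / 4 by norm_num] at hholder
  rw [gowersNorm_two, norm_div, Complex.norm_natCast, ← mul_div_assoc]
  refine div_le_div_of_nonneg_right ?_ hN.le
  refine le_of_mul_le_mul_left ?_ hN
  calc (N : ℝ) * ‖∑ n ∈ Finset.Icc 1 N,
            a (n : ZMod N) * Complex.exp (2 * Real.pi * Complex.I * (n : ℂ) * (t : ℂ))‖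
      = ‖∑ ξ, dft a ξ * ∑ n ∈ Icc 1 N,
          stdAddChar (ξ * (n : ZMod N)) * Complex.exp (2 * Real.pi * Complex.I * n * t)‖ := by
        rw [← natCast_mul_sum_Icc_mul_exp, norm_mul, Complex.norm_natCast]
    _ ≤ ∑ ξ, ‖dft a ξ‖ * (4 * N * w ξ) := by
        refine norm_sum_le_of_le _ fun ξ _ => ?_
        rw [norm_mul]
        gcongr
        exact norm_dft_linearPhase_le t ξ
    _ = 4 * N * ∑ ξ, ‖dft a ξ‖ * w ξ := by
        rw [mul_sum]
        exact sum_congr rfl fun ξ _ => by ring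
    _ ≤ 4 * N * ((∑ ξ, ‖dft a ξ‖ ^ 4) ^ (1 / 4 : ℝ) * K ^ (3 / 4 : ℝ)) := by
        gcongr
        refine hholder.trans ?_
        gcongr
    _ = _ := by ring
end

section
/- Let s ≥ 3, let ℓ₁, …, ℓ_s be distinct integers, let ℓ = |ℓ₁| + … + |ℓ_s|, and let Ñ be a prime with Ñ > 2ℓN for some N ∈ ℕ. Then there is a constant C depending only on ℓ such that for all functions a₁, …, a_s : ℤ/Ñℤ → ℂ with |a_j| ≤ 1: |E_{m,n ∈ ℤ_Ñ} 1_{[N]}(n) · ∏_{j=1}^s a_j(m + ℓ_j·n)| ≤ C · (min_{1≤j≤s} ‖a_j‖_{U^{s-1}(ℤ_Ñ)})^{1/2} + 2/Ñ. -/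
open Finset

lemma gowersNorm_nonneg (Q : ℕ) [NeZero Q] (s : ℕ) (a : ZMod Q → ℂ) : 0 ≤ gowersNorm Q s a := by
  induction s generalizing a with
  | zero => exact norm_nonneg _
  | succ s ih =>
    cases s with
    | zero => exact norm_nonneg _
    | succ s =>
      refine Real.rpow_nonneg (div_nonneg (sum_nonneg fun t _ => ?_) (Nat.cast_nonneg _)) _
      exact pow_nonneg (ih _) _

lemma gowersNorm_succ_succ_pow (Q : ℕ) [NeZero Q] (s : ℕ) (a : ZMod Q → ℂ) :
    gowersNorm Q (s + 2) a ^ 2 ^ (s + 2) =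
      (∑ t : ZMod Q,
        gowersNorm Q (s + 1) (fun n => a n * (starRingEnd ℂ) (a (n + t))) ^ 2 ^ (s + 1)) / Q := by
  have h : (0 : ℝ) ≤ (∑ t : ZMod Q,
      gowersNorm Q (s + 1) (fun n => a n * (starRingEnd ℂ) (a (n + t))) ^ 2 ^ (s + 1)) / Q :=
    div_nonneg (sum_nonneg fun t _ => pow_nonneg (gowersNorm_nonneg _ _ _) _) (Nat.cast_nonneg _)
  have := Real.rpow_inv_natCast_pow h (n := 2 ^ (s + 2)) (by positivity)
  rw [← this, gowersNorm]
  norm_num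

lemma sum_gowersNorm_le (Q : ℕ) [NeZero Q] (s : ℕ) (a : ZMod Q → ℂ) :
    ∑ t : ZMod Q, gowersNorm Q (s + 1) (fun n => a n * (starRingEnd ℂ) (a (n + t)))
      ≤ Q * gowersNorm Q (s + 2) a ^ 2 := by
  have hQ : (0 : ℝ) < Q := Nat.cast_pos.2 (NeZero.pos Q)
  set g : ZMod Q → ℝ :=
    fun t => gowersNorm Q (s + 1) (fun n => a n * (starRingEnd ℂ) (a (n + t))) with hg
  have key := pow_sum_div_card_le_sum_pow (s := univ) (f := g)
    (fun t _ => gowersNorm_nonneg _ _ _) (2 ^ (s + 1) - 1)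
  have h1 : 2 ^ (s + 1) - 1 + 1 = 2 ^ (s + 1) := Nat.sub_add_cancel Nat.one_le_two_pow
  rw [h1, card_univ, ZMod.card] at key
  have h2 := gowersNorm_succ_succ_pow Q s a
  have h3 : ((∑ t, g t) / Q) ^ 2 ^ (s + 1) ≤ (gowersNorm Q (s + 2) a ^ 2) ^ 2 ^ (s + 1) := by
    rw [← pow_mul, ← pow_succ', h2, div_pow]
    have : (Q : ℝ) ^ 2 ^ (s + 1) = (Q : ℝ) ^ (2 ^ (s + 1) - 1) * Q := by
      rw [← pow_succ, h1]
    rw [this, ← div_div]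
    gcongr
  have h4 := le_of_pow_le_pow_left₀ (by positivity) (by positivity) h3
  rwa [div_le_iff₀' hQ] at h4

/-- Weyl differencing: the phase `ψ` disappears after one application of Cauchy–Schwarz. -/
lemma norm_sq_sum_addChar_mul_le {Q : ℕ} [NeZero Q] (ψ : AddChar (ZMod Q) ℂ)
    (H : ZMod Q → ZMod Q → ℂ) :
    ∑ m, ‖∑ n, ψ n * H m n‖ ^ 2
      ≤ ∑ t, ‖∑ m, ∑ n, H m n * (starRingEnd ℂ) (H m (n + t))‖ := by
  have h : ((∑ m, ‖∑ n, ψ n * H m n‖ ^ 2 : ℝ) : ℂ) =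
      ∑ t, (starRingEnd ℂ) (ψ t) * ∑ m, ∑ n, H m n * (starRingEnd ℂ) (H m (n + t)) := by
    push_cast
    simp_rw [mul_sum]
    rw [sum_comm]
    refine sum_congr rfl fun m _ => ?_
    rw [← Complex.mul_conj', map_sum, sum_mul_sum]
    conv_rhs => rw [sum_comm]
    refine sum_congr rfl fun n _ => ?_
    rw [← Equiv.sum_comp (Equiv.addLeft n)]
    refine sum_congr rfl fun t _ => ?_
    have h1 : ψ n * (starRingEnd ℂ) (ψ n) = 1 := by
      rw [Complex.mul_conj', AddChar.norm_apply]; simp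
    simp only [Equiv.coe_addLeft, AddChar.map_add_eq_mul, map_mul]
    linear_combination H m n * (starRingEnd ℂ) (ψ t) * (starRingEnd ℂ) (H m (n + t)) * h1
  have h0 : 0 ≤ ∑ m, ‖∑ n, ψ n * H m n‖ ^ 2 := sum_nonneg fun _ _ => by positivity
  rw [← abs_of_nonneg h0, ← Real.norm_eq_abs, ← Complex.norm_real, h]
  refine (norm_sum_le _ _).trans (sum_le_sum fun t _ => ?_)
  rw [norm_mul, RCLike.norm_conj, AddChar.norm_apply, one_mul]

/-- The inductive step of the generalized von Neumann inequality, with an extra linear phase. -/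
lemma norm_sum_addChar_mul_prod_le_of_forall {Q : ℕ} [Fact Q.Prime] {ι : Type*} [DecidableEq ι]
    (k : ℕ) (i : ι)
    (ih : ∀ (S : Finset ι) (c : ι → ZMod Q) (a : ι → ZMod Q → ℂ), #S = k + 2 → i ∈ S →
      Set.InjOn c S → (∀ j x, ‖a j x‖ ≤ 1) →
      ‖∑ m, ∑ n, ∏ j ∈ S, a j (m + c j * n)‖ ≤ Q ^ 2 * gowersNorm Q (k + 1) (a i))
    (ψ : AddChar (ZMod Q) ℂ) (S : Finset ι) (c : ι → ZMod Q) (a : ι → ZMod Q → ℂ)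
    (hS : #S = k + 3) (hi : i ∈ S) (hc : Set.InjOn c S) (ha : ∀ j x, ‖a j x‖ ≤ 1) :
    ‖∑ m, ∑ n, ψ n * ∏ j ∈ S, a j (m + c j * n)‖ ≤ Q ^ 2 * gowersNorm Q (k + 2) (a i) := by
  obtain ⟨p, hp, hpi⟩ := exists_mem_ne (by omega : 1 < #S) i
  set d : ι → ZMod Q := fun j => c j - c p with hd
  set H : ZMod Q → ZMod Q → ℂ := fun m n => ∏ j ∈ S.erase p, a j (m + d j * n) with hH
  have h1 : ∑ m, ∑ n, ψ n * ∏ j ∈ S, a j (m + c j * n) = ∑ m, a p m * ∑ n, ψ n * H m n := by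
    simp_rw [mul_sum]
    rw [sum_comm, sum_comm (f := fun m n => a p m * _)]
    refine sum_congr rfl fun n _ => ?_
    rw [← Equiv.sum_comp (Equiv.subRight (c p * n))]
    refine sum_congr rfl fun m _ => ?_
    rw [← mul_prod_erase S _ hp]
    simp only [Equiv.subRight_apply, hH, hd]
    rw [sub_add_cancel, mul_left_comm]
    congr 2
    refine prod_congr rfl fun j _ => ?_
    congr 1
    ring
  have h2 : ‖∑ m, ∑ n, ψ n * ∏ j ∈ S, a j (m + c j * n)‖ ≤ ∑ m, ‖∑ n, ψ n * H m n‖ := by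
    rw [h1]
    refine (norm_sum_le _ _).trans (sum_le_sum fun m _ => ?_)
    rw [norm_mul]
    exact mul_le_of_le_one_left (norm_nonneg _) (ha _ _)
  have h3 : ∀ t, ‖∑ m, ∑ n, H m n * (starRingEnd ℂ) (H m (n + t))‖ ≤ Q ^ 2 *
      gowersNorm Q (k + 1) (fun x => a i x * (starRingEnd ℂ) (a i (x + d i * t))) := by
    intro t
    have := ih (S.erase p) d (fun j x => a j x * (starRingEnd ℂ) (a j (x + d j * t)))
      (by rw [card_erase_of_mem hp]; omega) (mem_erase.2 ⟨hpi.symm, hi⟩)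
      (fun x hx y hy hxy => hc (mem_of_mem_erase hx) (mem_of_mem_erase hy) (sub_left_injective hxy))
      (fun j x => by
        rw [norm_mul, RCLike.norm_conj]
        exact mul_le_one₀ (ha _ _) (norm_nonneg _) (ha _ _))
    refine le_of_eq_of_le ?_ this
    congr 1
    refine sum_congr rfl fun m _ => sum_congr rfl fun n _ => ?_
    simp only [hH, map_prod, ← prod_mul_distrib]
    refine prod_congr rfl fun j _ => ?_
    rw [mul_add, add_assoc]
  have hdi : d i ≠ 0 := sub_ne_zero.2 fun h => hpi (hc hi hp h).symm
  have h4 : ∑ t, ‖∑ m, ∑ n, H m n * (starRingEnd ℂ) (H m (n + t))‖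
      ≤ Q ^ 2 * (Q * gowersNorm Q (k + 2) (a i) ^ 2) := by
    refine (sum_le_sum fun t _ => h3 t).trans ?_
    rw [← mul_sum]
    refine mul_le_mul_of_nonneg_left ?_ (by positivity)
    refine le_of_eq_of_le ?_ (sum_gowersNorm_le Q k (a i))
    exact Equiv.sum_comp (Equiv.mulLeft₀ (d i) hdi)
      (fun t => gowersNorm Q (k + 1) (fun x => a i x * (starRingEnd ℂ) (a i (x + t))))
  have h5 := sq_sum_le_card_mul_sum_sq (s := univ) (f := fun m => ‖∑ n, ψ n * H m n‖)
  rw [card_univ, ZMod.card] at h5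
  refine le_of_sq_le_sq ?_ (mul_nonneg (by positivity) (gowersNorm_nonneg _ _ _))
  calc _ ≤ (∑ m, ‖∑ n, ψ n * H m n‖) ^ 2 := by gcongr
    _ ≤ Q * (Q ^ 2 * (Q * gowersNorm Q (k + 2) (a i) ^ 2)) := by
      refine h5.trans (mul_le_mul_of_nonneg_left ?_ (by positivity))
      exact (norm_sq_sum_addChar_mul_le ψ H).trans h4
    _ = _ := by ring

/-- The generalized von Neumann inequality for the forms `m + c j * n`. -/
lemma norm_sum_prod_le_gowersNorm {Q : ℕ} [Fact Q.Prime] {ι : Type*} [DecidableEq ι]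
    (k : ℕ) (i : ι) (S : Finset ι) (c : ι → ZMod Q) (a : ι → ZMod Q → ℂ)
    (hS : #S = k + 2) (hi : i ∈ S) (hc : Set.InjOn c S) (ha : ∀ j x, ‖a j x‖ ≤ 1) :
    ‖∑ m, ∑ n, ∏ j ∈ S, a j (m + c j * n)‖ ≤ Q ^ 2 * gowersNorm Q (k + 1) (a i) := by
  induction k generalizing S c a with
  | zero =>
    obtain ⟨p, hp, hpi⟩ := exists_mem_ne (by omega : 1 < #S) i
    have hS' : S.erase p = {i} := by
      obtain ⟨x, hx⟩ := card_eq_one.1 (by rw [card_erase_of_mem hp, hS] : #(S.erase p) = 1)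
      have : i ∈ S.erase p := mem_erase.2 ⟨hpi.symm, hi⟩
      rw [hx] at this ⊢
      rw [mem_singleton.1 this]
    have hdi : c i - c p ≠ 0 := sub_ne_zero.2 fun h => hpi (hc hi hp h).symm
    have h1 : ∑ m, ∑ n, ∏ j ∈ S, a j (m + c j * n) = (∑ m, a p m) * ∑ n, a i n := by
      have : ∀ n, ∑ m, ∏ j ∈ S, a j (m + c j * n) = ∑ m, a p m * a i (m + (c i - c p) * n) := by
        intro n
        rw [← Equiv.sum_comp (Equiv.subRight (c p * n))]
        refine sum_congr rfl fun m _ => ?_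
        rw [← mul_prod_erase S _ hp, hS', prod_singleton]
        simp only [Equiv.subRight_apply]
        rw [sub_add_cancel]
        congr 2
        ring
      rw [sum_comm]
      simp_rw [this]
      rw [sum_comm, sum_mul_sum]
      refine sum_congr rfl fun m _ => ?_
      exact Equiv.sum_comp ((Equiv.mulLeft₀ _ hdi).trans (Equiv.addLeft m))
        (fun x => a p m * a i x)
    have h2 : ‖∑ m, a p m‖ ≤ Q := by
      refine (norm_sum_le_of_le univ fun m _ => ha p m).trans ?_
      simp [ZMod.card]
    have hQ : (0 : ℝ) < Q := Nat.cast_pos.2 (NeZero.pos Q)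
    rw [h1, norm_mul, gowersNorm, norm_div, Complex.norm_natCast, sq, mul_assoc,
      mul_div_cancel₀ _ hQ.ne']
    gcongr
  | succ k ih =>
    have := norm_sum_addChar_mul_prod_le_of_forall k i ih 1 S c a hS hi hc ha
    simpa using this

lemma norm_sum_addChar_mul_prod_le_gowersNorm {Q : ℕ} [Fact Q.Prime] {ι : Type*} [DecidableEq ι]
    (k : ℕ) (i : ι) (ψ : AddChar (ZMod Q) ℂ) (S : Finset ι) (c : ι → ZMod Q) (a : ι → ZMod Q → ℂ)
    (hS : #S = k + 3) (hi : i ∈ S) (hc : Set.InjOn c S) (ha : ∀ j x, ‖a j x‖ ≤ 1) :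
    ‖∑ m, ∑ n, ψ n * ∏ j ∈ S, a j (m + c j * n)‖ ≤ Q ^ 2 * gowersNorm Q (k + 2) (a i) :=
  norm_sum_addChar_mul_prod_le_of_forall k i (norm_sum_prod_le_gowersNorm k i) ψ S c a hS hi hc ha

lemma sum_stdAddChar_mul {Q : ℕ} [NeZero Q] (b : ZMod Q) :
    ∑ x : ZMod Q, ZMod.stdAddChar (x * b) = if b = 0 then (Q : ℂ) else 0 := by
  rw [AddChar.sum_mulShift b (ZMod.isPrimitive_stdAddChar Q)]
  split_ifs <;> simp [ZMod.card]

lemma sum_norm_sq_sum_mul_stdAddChar {Q : ℕ} [NeZero Q] (g : ZMod Q → ℂ) :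
    ∑ ξ : ZMod Q, ‖∑ k, g k * ZMod.stdAddChar (ξ * k)‖ ^ 2 = Q * ∑ k, ‖g k‖ ^ 2 := by
  have h : ∀ ξ k l : ZMod Q, g k * ZMod.stdAddChar (ξ * k) *
      (starRingEnd ℂ) (g l * ZMod.stdAddChar (ξ * l)) =
      g k * (starRingEnd ℂ) (g l) * ZMod.stdAddChar (ξ * (k - l)) := by
    intro ξ k l
    rw [mul_sub, sub_eq_add_neg, AddChar.map_add_eq_mul, AddChar.map_neg_eq_conj,
      map_mul (starRingEnd ℂ)]
    ring
  rw [← Complex.ofReal_inj]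
  push_cast
  simp_rw [← Complex.mul_conj', map_sum, sum_mul_sum, h]
  rw [sum_comm, mul_sum]
  refine sum_congr rfl fun k _ => ?_
  rw [sum_comm]
  simp_rw [← mul_sum, sum_stdAddChar_mul, sub_eq_zero]
  simp
  ring

/-- A function with small Fourier coefficients has small correlation with convolutions. -/
lemma norm_sum_sum_mul_mul_le {Q : ℕ} [NeZero Q] (F : ZMod Q → ℂ) (B : ℝ)
    (hF : ∀ ψ : AddChar (ZMod Q) ℂ, ‖∑ n, ψ n * F n‖ ≤ B) (g h : ZMod Q → ℂ) :
    ‖∑ k, ∑ l, g k * h l * F (k + l)‖ ≤ B * √((∑ k, ‖g k‖ ^ 2) * ∑ l, ‖h l‖ ^ 2) := by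
  have hQ : (0 : ℝ) < Q := Nat.cast_pos.2 (NeZero.pos Q)
  have hB : 0 ≤ B := (norm_nonneg _).trans (hF 1)
  have h0 : ∀ ξ k l n : ZMod Q, g k * ZMod.stdAddChar (ξ * k) * (h l * ZMod.stdAddChar (ξ * l)) *
      (ZMod.stdAddChar (-ξ * n) * F n) = g k * h l * F n * ZMod.stdAddChar (ξ * (k + l - n)) := by
    intro ξ k l n
    rw [show ξ * (k + l - n) = ξ * k + ξ * l + -ξ * n by ring]
    simp only [AddChar.map_add_eq_mul]
    ring
  have h1 : (Q : ℂ) * ∑ k, ∑ l, g k * h l * F (k + l) =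
      ∑ ξ : ZMod Q, (∑ k, g k * ZMod.stdAddChar (ξ * k)) * (∑ l, h l * ZMod.stdAddChar (ξ * l)) *
        ∑ n, ZMod.stdAddChar (-ξ * n) * F n := by
    have h : ∀ ξ : ZMod Q, (∑ k, g k * ZMod.stdAddChar (ξ * k)) *
        (∑ l, h l * ZMod.stdAddChar (ξ * l)) * ∑ n, ZMod.stdAddChar (-ξ * n) * F n =
        ∑ k, ∑ l, ∑ n, g k * h l * F n * ZMod.stdAddChar (ξ * (k + l - n)) := by
      intro ξ
      rw [sum_mul_sum, sum_mul]
      refine sum_congr rfl fun k _ => ?_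
      rw [sum_mul]
      refine sum_congr rfl fun l _ => ?_
      simp_rw [mul_sum, h0]
    simp_rw [h]
    rw [mul_sum, sum_comm]
    refine sum_congr rfl fun k _ => ?_
    rw [mul_sum, sum_comm]
    refine sum_congr rfl fun l _ => ?_
    rw [sum_comm]
    simp_rw [← mul_sum, sum_stdAddChar_mul, sub_eq_zero]
    simp
    ring
  have h2 : Q * ‖∑ k, ∑ l, g k * h l * F (k + l)‖ ≤
      (∑ ξ : ZMod Q, ‖∑ k, g k * ZMod.stdAddChar (ξ * k)‖ *
        ‖∑ l, h l * ZMod.stdAddChar (ξ * l)‖) * B := by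
    have : (Q : ℝ) = ‖(Q : ℂ)‖ := (Complex.norm_natCast Q).symm
    rw [this, ← norm_mul, h1, sum_mul]
    refine (norm_sum_le _ _).trans (sum_le_sum fun ξ _ => ?_)
    rw [norm_mul, norm_mul]
    refine mul_le_mul_of_nonneg_left ?_ (by positivity)
    simpa [AddChar.mulShift_apply] using hF (ZMod.stdAddChar.mulShift (-ξ))
  have h3 : ∑ ξ : ZMod Q, ‖∑ k, g k * ZMod.stdAddChar (ξ * k)‖ *
        ‖∑ l, h l * ZMod.stdAddChar (ξ * l)‖ ≤
      Q * √((∑ k, ‖g k‖ ^ 2) * ∑ l, ‖h l‖ ^ 2) := by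
    refine le_of_sq_le_sq ((sum_mul_sq_le_sq_mul_sq _ _ _).trans ?_) (by positivity)
    rw [sum_norm_sq_sum_mul_stdAddChar, sum_norm_sq_sum_mul_stdAddChar, mul_pow,
      Real.sq_sqrt (by positivity)]
    exact le_of_eq (by ring)
  refine le_of_mul_le_mul_left ((h2.trans (mul_le_mul_of_nonneg_right h3 hB)).trans_eq ?_) hQ
  ring

/-- The indicator function of `{1, …, N}` in `ZMod Q`. -/
noncomputable def intervalIndicator (N Q : ℕ) (n : ZMod Q) : ℂ :=
  if 1 ≤ n.val ∧ n.val ≤ N then 1 else 0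

lemma norm_intervalIndicator_le (N Q : ℕ) (n : ZMod Q) : ‖intervalIndicator N Q n‖ ≤ 1 := by
  unfold intervalIndicator
  split_ifs <;> simp

lemma sum_norm_intervalIndicator_add_one_sub {N Q : ℕ} [NeZero Q] (hN : N < Q) :
    ∑ n, ‖intervalIndicator N Q (n + 1) - intervalIndicator N Q n‖ ≤ 2 := by
  have h : ∀ n, ‖intervalIndicator N Q (n + 1) - intervalIndicator N Q n‖ ≤
      (if n = 0 then 1 else 0) + if n = (N : ZMod Q) then 1 else 0 := by
    intro n
    have hv := ZMod.val_lt n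
    have h0 : n = 0 ↔ n.val = 0 := (ZMod.val_eq_zero n).symm
    have h1 : n = (N : ZMod Q) ↔ n.val = N := by
      rw [← (ZMod.val_injective Q).eq_iff, ZMod.val_cast_of_lt hN]
    have h2 : (n + 1).val = if n.val + 1 = Q then 0 else n.val + 1 := by
      have : n + 1 = ((n.val + 1 : ℕ) : ZMod Q) := by simp
      rw [this, ZMod.val_natCast]
      split_ifs with h
      · rw [h, Nat.mod_self]
      · exact Nat.mod_eq_of_lt (by omega)
    simp only [h0, h1, intervalIndicator, h2]
    split_ifs <;> first | omega | norm_num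
  refine (sum_le_sum fun n _ => h n).trans (le_of_eq ?_)
  rw [sum_add_distrib, sum_ite_eq' univ, sum_ite_eq' univ]
  norm_num

lemma sum_norm_intervalIndicator_add_sub {N Q : ℕ} [NeZero Q] (hN : N < Q) (j : ℕ) :
    ∑ n, ‖intervalIndicator N Q (n + j) - intervalIndicator N Q n‖ ≤ 2 * j := by
  induction j with
  | zero => simp
  | succ j ih =>
    have h1 : ∑ n, ‖intervalIndicator N Q (n + j + 1) - intervalIndicator N Q (n + j)‖ ≤ 2 :=
      (Equiv.sum_comp (Equiv.addRight (j : ZMod Q)) (fun n =>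
        ‖intervalIndicator N Q (n + 1) - intervalIndicator N Q n‖)).trans_le
        (sum_norm_intervalIndicator_add_one_sub hN)
    push_cast
    have h2 : ∀ n, ‖intervalIndicator N Q (n + (j + 1)) - intervalIndicator N Q n‖ ≤
        ‖intervalIndicator N Q (n + j + 1) - intervalIndicator N Q (n + j)‖ +
        ‖intervalIndicator N Q (n + j) - intervalIndicator N Q n‖ := fun n => by
      rw [← add_assoc]
      exact norm_sub_le_norm_sub_add_norm_sub _ _ _
    have h3 := sum_le_sum fun n (_ : n ∈ univ) => h2 n
    rw [sum_add_distrib] at h3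
    linarith

lemma card_filter_val_lt {Q K : ℕ} [NeZero Q] (hK : K ≤ Q) :
    #{l : ZMod Q | l.val < K} = K := by
  conv_rhs => rw [← card_range K]
  refine card_bij (fun l _ => l.val) (by simp) (fun a _ b _ h => ZMod.val_injective Q h) ?_
  intro b hb
  rw [mem_range] at hb
  have : ((b : ZMod Q)).val = b := ZMod.val_cast_of_lt (by omega)
  exact ⟨b, by simpa [this] using hb, this⟩

/-- Summing a function with small Fourier coefficients over an interval, by comparison with a
trapezoid whose sides have width `K`. -/
lemma norm_sum_intervalIndicator_mul_le {N Q K : ℕ} [NeZero Q] (hN : N < Q) (hK0 : 0 < K)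
    (hK : K ≤ Q) (F : ZMod Q → ℂ) (B M : ℝ) (hM : ∀ n, ‖F n‖ ≤ M)
    (hF : ∀ ψ : AddChar (ZMod Q) ℂ, ‖∑ n, ψ n * F n‖ ≤ B) :
    K * ‖∑ n, intervalIndicator N Q n * F n‖ ≤ B * √(Q * K) + K * (2 * (K - 1) * M) := by
  set g := intervalIndicator N Q with hg
  set h : ZMod Q → ℂ := fun l => if l.val < K then 1 else 0 with hh
  have hM0 : 0 ≤ M := (norm_nonneg _).trans (hM 0)
  have hB : 0 ≤ B := (norm_nonneg _).trans (hF 1)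
  have hsum : ∑ l, h l = K := by
    simp only [hh]
    rw [sum_boole, card_filter_val_lt hK]
  have hn : ∀ l, ‖h l‖ = if l.val < K then 1 else 0 := fun l => by
    simp only [hh]; split_ifs <;> simp
  have hnorm : ∑ l, ‖h l‖ = K := by
    simp_rw [hn]
    rw [sum_boole, card_filter_val_lt hK]
  have hnorm2 : ∑ l, ‖h l‖ ^ 2 = K := by
    rw [← hnorm]
    refine sum_congr rfl fun l _ => ?_
    rw [hn]; split_ifs <;> simp
  have hg2 : ∑ k, ‖g k‖ ^ 2 ≤ Q := by
    refine (sum_le_sum fun k _ => pow_le_one₀ (norm_nonneg _)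
      (norm_intervalIndicator_le N Q k)).trans ?_
    simp [ZMod.card]
  have h1 := norm_sum_sum_mul_mul_le F B hF g h
  have h2 : (K : ℂ) * ∑ n, g n * F n = (∑ k, ∑ l, g k * h l * F (k + l)) +
      ∑ l, h l * ∑ n, (g (n + l) - g n) * F (n + l) := by
    have e1 : ∀ l, ∑ n, g (n + l) * F (n + l) = ∑ n, g n * F n := fun l =>
      Equiv.sum_comp (Equiv.addRight l) (fun n => g n * F n)
    rw [sum_comm, ← hsum, sum_mul, ← sum_add_distrib]
    refine sum_congr rfl fun l _ => ?_
    simp_rw [sub_mul, sum_sub_distrib, e1, mul_sub, mul_sum]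
    have e2 : ∀ n, g n * h l * F (n + l) = h l * (g n * F (n + l)) := fun n => by ring
    simp_rw [e2]
    ring
  have h3 : ‖∑ l, h l * ∑ n, (g (n + l) - g n) * F (n + l)‖ ≤ K * (2 * (K - 1) * M) := by
    rw [← hnorm, sum_mul, hnorm]
    refine (norm_sum_le _ _).trans (sum_le_sum fun l _ => ?_)
    rw [norm_mul, hn]
    split_ifs with hl
    · rw [one_mul, one_mul]
      have e1 := sum_norm_intervalIndicator_add_sub hN l.val
      rw [ZMod.natCast_zmod_val] at e1
      have e2 : (l.val : ℝ) ≤ K - 1 := by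
        rw [le_sub_iff_add_le]; exact_mod_cast hl
      refine (norm_sum_le _ _).trans ?_
      calc _ ≤ ∑ n, ‖g (n + l) - g n‖ * M := by
            refine sum_le_sum fun n _ => ?_
            rw [norm_mul]
            exact mul_le_mul_of_nonneg_left (hM _) (norm_nonneg _)
        _ ≤ _ := by
            rw [← sum_mul]
            refine mul_le_mul_of_nonneg_right (e1.trans ?_) hM0
            linarith
    · simp
  have h4 : (K : ℝ) * ‖∑ n, g n * F n‖ = ‖(K : ℂ) * ∑ n, g n * F n‖ := by
    rw [norm_mul, Complex.norm_natCast]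
  rw [h4, h2]
  refine (norm_add_le _ _).trans (add_le_add (h1.trans ?_) h3)
  rw [hnorm2]
  gcongr

lemma norm_sum_intervalIndicator_mul_le_sqrt {N Q : ℕ} [NeZero Q] (hN : N < Q)
    (F : ZMod Q → ℂ) (U : ℝ) (hM : ∀ n, ‖F n‖ ≤ Q)
    (hF : ∀ ψ : AddChar (ZMod Q) ℂ, ‖∑ n, ψ n * F n‖ ≤ Q ^ 2 * U) :
    ‖∑ n, intervalIndicator N Q n * F n‖ ≤ Q ^ 2 * (3 * √U) := by
  have hQ : (0 : ℝ) < Q := Nat.cast_pos.2 (NeZero.pos Q)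
  have hU : 0 ≤ U := by
    have := (norm_nonneg _).trans (hF 1)
    exact nonneg_of_mul_nonneg_right this (by positivity)
  rcases le_or_gt 1 U with h1 | h1
  · have hs : 1 ≤ √U := Real.one_le_sqrt.2 h1
    have : ‖∑ n, intervalIndicator N Q n * F n‖ ≤ Q * Q := by
      refine (norm_sum_le_of_le univ (f := fun n => intervalIndicator N Q n * F n)
        (n := fun _ => (Q : ℝ)) fun n _ => ?_).trans ?_
      · rw [norm_mul]
        exact (mul_le_of_le_one_left (norm_nonneg _) (norm_intervalIndicator_le _ _ _)).trans (hM n)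
      · simp [ZMod.card]
    nlinarith
  · set K := ⌊U * Q⌋₊ + 1 with hK
    have hKQ : K ≤ Q := by
      have : ⌊U * Q⌋₊ < Q := (Nat.floor_lt (by positivity)).2 (by nlinarith)
      omega
    have hK1 : (K : ℝ) - 1 ≤ U * Q := by
      rw [hK]; push_cast
      linarith [Nat.floor_le (show 0 ≤ U * Q by positivity)]
    have hK2 : U * Q ≤ K := by
      rw [hK]; push_cast
      exact (Nat.lt_floor_add_one _).le
    have hK0 : (0 : ℝ) < K := by rw [hK]; positivity
    have key := norm_sum_intervalIndicator_mul_le hN (Nat.succ_pos _ : 0 < K) hKQ F _ _ hM hF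
    have hs1 : U ≤ √U := by
      conv_lhs => rw [← Real.mul_self_sqrt hU]
      exact mul_le_of_le_one_left (Real.sqrt_nonneg _) (Real.sqrt_le_one.2 h1.le)
    have hs2 : U * √(Q * K) ≤ K * √U := by
      have : √U * √(Q * K) ≤ K := by
        rw [← Real.sqrt_mul hU]
        refine Real.sqrt_le_iff.2 ⟨hK0.le, ?_⟩
        nlinarith
      calc U * √(Q * K) = √U * (√U * √(Q * K)) := by
            rw [← mul_assoc, Real.mul_self_sqrt hU]
        _ ≤ √U * K := by gcongr
        _ = _ := mul_comm _ _
    refine le_of_mul_le_mul_left (key.trans ?_) hK0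
    calc _ = Q ^ 2 * (U * √(Q * K)) + K * (2 * (K - 1) * Q) := by ring
      _ ≤ Q ^ 2 * (K * √U) + K * (2 * (√U * Q) * Q) := by
        gcongr
        exact hK1.trans (by gcongr)
      _ = _ := by ring

/-- Generalized von Neumann estimate: for `s ≥ 3`, distinct integers `ℓ₁,…,ℓ_s` with
`ℓ = |ℓ₁|+⋯+|ℓ_s|`, a prime `Ñ > 2ℓN`, and `1`-bounded `a₁,…,a_s : ℤ/Ñℤ → ℂ`:
`|E_{m,n∈ℤ_Ñ} 1_{[N]}(n) ∏ⱼ aⱼ(m+ℓⱼn)| ≤ C (minⱼ ‖aⱼ‖_{U^{s-1}(ℤ_Ñ)})^{1/2} + 2/Ñ`,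
with `C` depending only on `ℓ`. -/
theorem stmt_17 (s : ℕ) (hs : 3 ≤ s) (ℓ : Fin s → ℤ) (hℓ : Function.Injective ℓ) :
    ∃ C : ℝ, 0 < C ∧
      ∀ (N Q : ℕ) [NeZero Q], Q.Prime → 2 * (∑ j, (ℓ j).natAbs) * N < Q →
        ∀ a : Fin s → ZMod Q → ℂ, (∀ j x, ‖a j x‖ ≤ 1) →
          ‖(∑ m : ZMod Q, ∑ n : ZMod Q,
              (if 1 ≤ n.val ∧ n.val ≤ N then (1 : ℂ) else 0) *
                ∏ j, a j (m + (ℓ j : ZMod Q) * n)) / (Q : ℂ) ^ 2‖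
            ≤ C * Real.sqrt (⨅ j, gowersNorm Q (s - 1) (a j)) + 2 / (Q : ℝ) := by
  refine ⟨3, by norm_num, ?_⟩
  intro N Q _ hQ hNQ a ha
  have : Fact Q.Prime := ⟨hQ⟩
  have hQ0 : (0 : ℝ) < Q := Nat.cast_pos.2 hQ.pos
  refine le_add_of_le_of_nonneg ?_ (by positivity)
  rcases Nat.eq_zero_or_pos N with rfl | hN
  · have h0 : ∀ n : ZMod Q, ¬ (1 ≤ n.val ∧ n.val ≤ 0) := fun n => by omega
    simp only [h0, if_false, zero_mul, sum_const_zero, zero_div, norm_zero]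
    positivity
  have hne : ∀ i j : Fin s, i ≠ j → 1 ≤ (ℓ i - ℓ j).natAbs ∧
      (ℓ i - ℓ j).natAbs ≤ ∑ j, (ℓ j).natAbs := by
    intro i j hij
    have h1 : ℓ i ≠ ℓ j := fun h => hij (hℓ h)
    have h2 : (ℓ i).natAbs + (ℓ j).natAbs ≤ ∑ j, (ℓ j).natAbs := by
      rw [← sum_pair (f := fun j => (ℓ j).natAbs) hij]
      exact sum_le_sum_of_subset (subset_univ _)
    omega
  have hL := hne ⟨0, by omega⟩ ⟨1, by omega⟩ (by simp)
  have hNQ' : N < Q := by nlinarith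
  have hc : Function.Injective (fun j => (ℓ j : ZMod Q)) := by
    intro i j hij
    by_contra hne'
    have h1 := hne i j hne'
    have h2 : (Q : ℤ) ∣ ℓ i - ℓ j := (ZMod.intCast_eq_intCast_iff_dvd_sub _ _ _).1 hij.symm
    have h3 := Nat.le_of_dvd h1.1 (Int.natCast_dvd.1 h2)
    nlinarith
  have : Nonempty (Fin s) := ⟨⟨0, by omega⟩⟩
  obtain ⟨i, hi⟩ := exists_eq_ciInf_of_finite (f := fun j => gowersNorm Q (s - 1) (a j))
  rw [← hi, norm_div, norm_pow, Complex.norm_natCast, div_le_iff₀' (by positivity)]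
  have key := norm_sum_intervalIndicator_mul_le_sqrt hNQ'
    (fun n => ∑ m, ∏ j, a j (m + (ℓ j : ZMod Q) * n)) (gowersNorm Q (s - 1) (a i)) ?_ ?_
  · rw [sum_comm]
    simpa only [intervalIndicator, mul_sum] using key
  · intro n
    refine (norm_sum_le_of_le univ (n := fun _ => (1 : ℝ)) fun m _ => ?_).trans (by simp [ZMod.card])
    rw [norm_prod]
    exact prod_le_one (fun _ _ => norm_nonneg _) fun j _ => ha _ _
  · intro ψ
    obtain ⟨k, rfl⟩ := Nat.exists_eq_add_of_le' hs
    have := norm_sum_addChar_mul_prod_le_gowersNorm k i ψ univ (fun j => (ℓ j : ZMod Q)) a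
      (by simp) (mem_univ _) hc.injOn ha
    rw [sum_comm] at this
    simp only [mul_sum]
    exact this
end
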